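/- Let Ω ⊂ ℝⁿ be a bounded open set and let p : Ω → ℝ be C¹ with 1 < inf_Ω p ≤ sup_Ω p < ∞. Suppose u : Ω → ℝ is continuous and locally Lipschitz and satisfies ∫_Ω |Du(x)|^{p(x)−2} ⟨Du(x), Dψ(x)⟩ dx ≥ 0 for every nonnegative smooth function ψ with compact support in Ω (where Du is the almost-everywhere defined gradient and the integrand is taken to be 0 where Du(x) = 0). Then u is a viscosity supersolution of −Δ_{p(·)}u = 0 in Ω. -/

import Mathlib

open MeasureTheory Metric Set Filter Asymptotics
open scoped RealInnerProductSpace NNReal Topology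

noncomputable section

abbrev En (n : ℕ) := EuclideanSpace ℝ (Fin n)

/-- The nondivergence-form `p(·)`-Laplacian `-Δ_{p(·)} φ` at `x`. -/
noncomputable def negPLap {n : ℕ} (p φ : En n → ℝ) (x : En n) : ℝ :=
  -(‖gradient φ x‖ ^ (p x - 2) *
      LinearMap.trace ℝ (En n) (fderiv ℝ (gradient φ) x : En n →ₗ[ℝ] En n))
  - (p x - 2) * ‖gradient φ x‖ ^ (p x - 4) *
      ⟪fderiv ℝ (gradient φ) x (gradient φ x), gradient φ x⟫
  - ‖gradient φ x‖ ^ (p x - 2) * Real.log ‖gradient φ x‖ *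
      ⟪gradient p x, gradient φ x⟫

/-- `u` is a viscosity supersolution of `-Δ_{p(·)} u = 0` on an open set `D`. -/
def IsViscositySupersolution {n : ℕ} (p u : En n → ℝ) (D : Set (En n)) : Prop :=
  ∀ x₀ ∈ D, ∀ φ : En n → ℝ,
    ContDiffAt ℝ 2 φ x₀ → φ x₀ = u x₀ →
    (∀ᶠ x in 𝓝[≠] x₀, φ x < u x) →
    gradient φ x₀ ≠ 0 → 0 ≤ negPLap p φ x₀

/-- The infimal convolution `u_ε` of `u`. -/
noncomputable def infConv {n : ℕ} (u : En n → ℝ) (Ω : Set (En n)) (q ε : ℝ) (x : En n) : ℝ :=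
  sInf ((fun y => u y + ‖x - y‖ ^ q / (q * ε ^ (q - 1))) '' Ω)

/-- `r(ε) = (q ε^{q-1} (M - m))^{1/q}` where `M = sup u`, `m = inf u`. -/
noncomputable def rEps {n : ℕ} (u : En n → ℝ) (Ω : Set (En n)) (q ε : ℝ) : ℝ :=
  (q * ε ^ (q - 1) * (sSup (u '' Ω) - sInf (u '' Ω))) ^ (1 / q)

/-- `Ω_r = {x ∈ Ω : dist(x, ∂Ω) > r}`. -/
def innerSet {n : ℕ} (Ω : Set (En n)) (r : ℝ) : Set (En n) :=
  {x ∈ Ω | r < Metric.infDist x (frontier Ω)}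

/-- The set of minimizers `Y_ε(x)`. -/
def Yset {n : ℕ} (u : En n → ℝ) (Ω : Set (En n)) (q ε : ℝ) (x : En n) : Set (En n) :=
  {y ∈ Ω | infConv u Ω q ε x = u y + ‖x - y‖ ^ q / (q * ε ^ (q - 1))}

/-- `f` is locally Lipschitz on `s`. -/
def LocLipschitzOn {n : ℕ} (f : En n → ℝ) (s : Set (En n)) : Prop :=
  ∀ x ∈ s, ∃ K : ℝ≥0, ∃ t ∈ 𝓝[s] x, LipschitzOnWith K f t

open Classical in
/-- `|Du(x)|^{p(x)-2} ⟨Du(x), Dψ(x)⟩`, taken to be `0` where `Du(x) = 0`. -/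
noncomputable def weakIntegrand {n : ℕ} (p u ψ : En n → ℝ) (x : En n) : ℝ :=
  if gradient u x = 0 then 0
  else ‖gradient u x‖ ^ (p x - 2) * ⟪gradient u x, gradient ψ x⟫

/-- The vector field `|Dφ|^{p-2} Dφ`. -/
def pFlux {n : ℕ} (p φ : En n → ℝ) (x : En n) : En n :=
  ‖gradient φ x‖ ^ (p x - 2) • gradient φ x

lemma weakIntegrand_eq_inner_pFlux {n : ℕ} (p u ψ : En n → ℝ) (x : En n) :
    weakIntegrand p u ψ x = ⟪pFlux p u x, gradient ψ x⟫ := by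
  unfold weakIntegrand pFlux
  split_ifs with h
  · simp [h]
  · rw [real_inner_smul_left]

lemma gradient_apply_eq_fderiv_single {n : ℕ} (f : En n → ℝ) (x : En n) (i : Fin n) :
    gradient f x i = fderiv ℝ f x (EuclideanSpace.single i 1) := by
  rw [← inner_gradient_left, EuclideanSpace.inner_single_right]
  simp

lemma real_inner_eq_sum_mul {n : ℕ} (v w : En n) : ⟪v, w⟫ = ∑ i, v i * w i := by
  simp [PiLp.inner_apply, mul_comm]

lemma norm_gradient {n : ℕ} (f : En n → ℝ) (x : En n) : ‖gradient f x‖ = ‖fderiv ℝ f x‖ := by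
  simp [gradient]

lemma measurable_gradient {n : ℕ} (f : En n → ℝ) : Measurable (gradient f) :=
  (InnerProductSpace.toDual ℝ (En n)).symm.continuous.measurable.comp (measurable_fderiv ℝ f)

/-- Monotonicity of `v ↦ |v|^{q-2} v`. -/
lemma inner_rpow_smul_sub_le {E : Type*} [NormedAddCommGroup E] [InnerProductSpace ℝ E]
    {q : ℝ} (hq : 1 < q) (a b : E) :
    ⟪‖a‖ ^ (q - 2) • a, b - a⟫ ≤ ⟪‖b‖ ^ (q - 2) • b, b - a⟫ := by
  have key : ∀ c : E, ‖c‖ ^ (q - 2) * ‖c‖ = ‖c‖ ^ (q - 1) := fun c => by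
    rcases eq_or_ne c 0 with rfl | hc
    · rw [norm_zero, mul_zero, Real.zero_rpow (by linarith)]
    · rw [← Real.rpow_add_one (norm_ne_zero_iff.2 hc)]; ring_nf
  have hmono : 0 ≤ (‖b‖ ^ (q - 1) - ‖a‖ ^ (q - 1)) * (‖b‖ - ‖a‖) := by
    rcases le_total ‖a‖ ‖b‖ with h | h
    · exact mul_nonneg (sub_nonneg.2 (Real.rpow_le_rpow (norm_nonneg _) h (by linarith)))
        (sub_nonneg.2 h)
    · exact mul_nonneg_of_nonpos_of_nonpos
        (sub_nonpos.2 (Real.rpow_le_rpow (norm_nonneg _) h (by linarith))) (sub_nonpos.2 h)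
  have hcs : ⟪a, b⟫ ≤ ‖a‖ * ‖b‖ := real_inner_le_norm a b
  have ha : 0 ≤ ‖a‖ ^ (q - 2) := by positivity
  have hb : 0 ≤ ‖b‖ ^ (q - 2) := by positivity
  rw [← key a, ← key b] at hmono
  simp only [real_inner_smul_left, inner_sub_right, real_inner_self_eq_norm_sq,
    real_inner_comm a b]
  nlinarith [mul_le_mul_of_nonneg_left hcs (add_nonneg ha hb)]

lemma norm_pFlux_le {n : ℕ} {p u : En n → ℝ} {x : En n} {K P : ℝ} (hp : 1 < p x) (hP : p x ≤ P)
    (hK : ‖gradient u x‖ ≤ K) : ‖pFlux p u x‖ ≤ (1 + K) ^ (P - 1) := by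
  have h0 := norm_nonneg (gradient u x)
  have key : ‖pFlux p u x‖ = ‖gradient u x‖ ^ (p x - 1) := by
    rw [pFlux, norm_smul, Real.norm_of_nonneg (by positivity)]
    rcases eq_or_ne (gradient u x) 0 with hc | hc
    · rw [hc, norm_zero, mul_zero, Real.zero_rpow (by linarith)]
    · rw [← Real.rpow_add_one (norm_ne_zero_iff.2 hc)]; ring_nf
  rw [key]
  calc ‖gradient u x‖ ^ (p x - 1) ≤ (1 + K) ^ (p x - 1) :=
        Real.rpow_le_rpow h0 (by linarith) (by linarith)
    _ ≤ (1 + K) ^ (P - 1) := Real.rpow_le_rpow_of_exponent_le (by linarith) (by linarith)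

lemma ContDiffAt.gradient_one {n : ℕ} {φ : En n → ℝ} {x : En n} (hφ : ContDiffAt ℝ 2 φ x) :
    ContDiffAt ℝ 1 (gradient φ) x :=
  (InnerProductSpace.toDual ℝ (En n)).symm.contDiff.contDiffAt.comp x
    (hφ.fderiv_right (m := 1) (by norm_num))

lemma contDiffAt_pFlux {n : ℕ} {p φ : En n → ℝ} {x : En n} (hφ : ContDiffAt ℝ 2 φ x)
    (hp : ContDiffAt ℝ 1 p x) (h0 : gradient φ x ≠ 0) : ContDiffAt ℝ 1 (pFlux p φ) x :=
  ((hφ.gradient_one.norm ℝ h0).rpow (hp.sub contDiffAt_const) (norm_ne_zero_iff.2 h0)).smul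
    hφ.gradient_one

lemma hasFDerivAt_norm_gradient_rpow {n : ℕ} {p φ : En n → ℝ} {x : En n}
    (hφ : ContDiffAt ℝ 2 φ x) (hp : DifferentiableAt ℝ p x) (h0 : gradient φ x ≠ 0) :
    HasFDerivAt (fun y => ‖gradient φ y‖ ^ (p y - 2))
      (((p x - 2) * ‖gradient φ x‖ ^ (p x - 4)) •
          (innerSL ℝ (gradient φ x)).comp (fderiv ℝ (gradient φ) x) +
        (‖gradient φ x‖ ^ (p x - 2) * Real.log ‖gradient φ x‖) • fderiv ℝ p x) x := by
  have hg : HasFDerivAt (gradient φ) (fderiv ℝ (gradient φ) x) x :=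
    (hφ.gradient_one.differentiableAt one_ne_zero).hasFDerivAt
  have hpow : ∀ (c : En n) (s : ℝ), (‖c‖ ^ 2) ^ (s / 2) = ‖c‖ ^ s := fun c s => by
    rw [← Real.rpow_natCast, ← Real.rpow_mul (norm_nonneg _)]
    congr 1; push_cast; ring
  have hpos : 0 < ‖gradient φ x‖ ^ 2 := by positivity
  have h := hg.norm_sq.rpow ((hp.hasFDerivAt.sub_const 2).mul_const (1 / 2 : ℝ)) hpos
  have hfun : (fun y => ‖gradient φ y‖ ^ (p y - 2)) =
      fun y => (‖gradient φ y‖ ^ 2) ^ ((p y - 2) * (1 / 2)) := by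
    funext y
    rw [← hpow]; ring_nf
  rw [hfun]
  convert! h using 1
  have e1 : (‖gradient φ x‖ ^ 2) ^ ((p x - 2) * (1 / 2)) = ‖gradient φ x‖ ^ (p x - 2) := by
    rw [← hpow]; ring_nf
  have e2 : (‖gradient φ x‖ ^ 2) ^ ((p x - 2) * (1 / 2) - 1) = ‖gradient φ x‖ ^ (p x - 4) := by
    rw [← hpow]; ring_nf
  rw [e1, e2]
  ext v
  simp [Real.log_pow]
  ring

/-- The divergence of `|Dφ|^{p-2} Dφ` is the nondivergence-form `p(·)`-Laplacian. -/
lemma sum_fderiv_pFlux {n : ℕ} {p φ : En n → ℝ} {x : En n}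
    (hφ : ContDiffAt ℝ 2 φ x) (hp : DifferentiableAt ℝ p x) (h0 : gradient φ x ≠ 0) :
    ∑ i, fderiv ℝ (pFlux p φ) x (EuclideanSpace.single i 1) i = -negPLap p φ x := by
  have hg : HasFDerivAt (gradient φ) (fderiv ℝ (gradient φ) x) x :=
    (hφ.gradient_one.differentiableAt one_ne_zero).hasFDerivAt
  have hN := hasFDerivAt_norm_gradient_rpow hφ hp h0
  have hV : fderiv ℝ (pFlux p φ) x = _ := (hN.smul hg).fderiv
  set ℓ := ((p x - 2) * ‖gradient φ x‖ ^ (p x - 4)) •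
          (innerSL ℝ (gradient φ x)).comp (fderiv ℝ (gradient φ) x) +
        (‖gradient φ x‖ ^ (p x - 2) * Real.log ‖gradient φ x‖) • fderiv ℝ p x with hℓ
  have hsum : ∑ i, ℓ (EuclideanSpace.single i 1) * gradient φ x i = ℓ (gradient φ x) := by
    conv_rhs => rw [← (EuclideanSpace.basisFun (Fin n) ℝ).sum_repr (gradient φ x)]
    simp only [map_sum, map_smul, smul_eq_mul, EuclideanSpace.basisFun_apply,
      EuclideanSpace.basisFun_repr]
    exact Finset.sum_congr rfl fun i _ => mul_comm _ _
  have htr : LinearMap.trace ℝ (En n) (fderiv ℝ (gradient φ) x : En n →ₗ[ℝ] En n) =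
      ∑ i, fderiv ℝ (gradient φ) x (EuclideanSpace.single i 1) i := by
    rw [LinearMap.trace_eq_sum_inner _ (EuclideanSpace.basisFun (Fin n) ℝ)]
    simp [EuclideanSpace.inner_single_left]
  rw [hV]
  simp only [add_apply, smul_apply,
    ContinuousLinearMap.smulRight_apply, PiLp.add_apply, PiLp.smul_apply, smul_eq_mul,
    Finset.sum_add_distrib, ← Finset.mul_sum, hsum, ← htr]
  simp only [negPLap, hℓ, add_apply, smul_apply,
    ContinuousLinearMap.comp_apply, innerSL_apply_apply, smul_eq_mul]
  rw [← inner_gradient_left (f := p), real_inner_comm (fderiv ℝ (gradient φ) x (gradient φ x))]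
  ring

open scoped Convolution

/-- Truncating a Lipschitz function that is nonpositive on a sphere to zero outside the ball. -/
lemma LipschitzOnWith.exists_lipschitzWith_posPart_ball {n : ℕ} {f : En n → ℝ} {x₀ : En n}
    {r : ℝ} (hr : 0 < r) {K : ℝ≥0} (hf : LipschitzOnWith K f (closedBall x₀ r))
    (hs : ∀ x ∈ sphere x₀ r, f x ≤ 0) :
    ∃ (ψ : En n → ℝ) (L : ℝ≥0), LipschitzWith L ψ ∧ (∀ x ∈ closedBall x₀ r, ψ x = max (f x) 0) ∧
      ∀ x ∉ ball x₀ r, ψ x = 0 := by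
  obtain ⟨F, hF, hfF⟩ := hf.extend_real
  have hd : LipschitzWith 1 fun x : En n => max (dist x x₀ - r) 0 := by
    simpa [sub_eq_add_neg] using
      ((LipschitzWith.dist_left x₀).add (LipschitzWith.const (-r))).max_const 0
  have hd' := (lipschitzWith_smul (K : ℝ)).comp hd
  refine ⟨fun x => max (F x - K * max (dist x x₀ - r) 0) 0, _, (hF.sub hd').max_const 0, ?_, ?_⟩
  · intro x hx
    have : dist x x₀ - r ≤ 0 := sub_nonpos.2 hx
    simp only [max_eq_right this, mul_zero, sub_zero, hfF hx]
  · intro x hx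
    have hx' : r ≤ dist x x₀ := by simpa using hx
    have hd0 : 0 < dist x x₀ := hr.trans_le hx'
    apply max_eq_right
    rw [max_eq_left (sub_nonneg.2 hx')]
    set y := x₀ + (r / dist x x₀) • (x - x₀) with hy
    have hyx₀ : dist y x₀ = r := by
      rw [dist_eq_norm, hy, add_sub_cancel_left, norm_smul, ← dist_eq_norm, Real.norm_eq_abs,
        abs_of_pos (by positivity)]
      field_simp
    have hxy : dist x y = dist x x₀ - r := by
      have : x - y = (1 - r / dist x x₀) • (x - x₀) := by
        rw [hy, sub_smul, one_smul]; abel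
      rw [dist_eq_norm, this, norm_smul, ← dist_eq_norm x x₀, Real.norm_eq_abs, abs_of_nonneg]
      · field_simp
      · rw [sub_nonneg, div_le_one hd0]; exact hx'
    have h1 := hF.dist_le_mul x y
    have h2 : F y ≤ 0 := by
      rw [← hfF (sphere_subset_closedBall hyx₀)]; exact hs y hyx₀
    rw [hxy, Real.dist_eq] at h1
    linarith [le_abs_self (F x - F y)]

/-- The derivative of the mollification of a Lipschitz function is the mollification of its line
derivative. -/
lemma fderiv_normed_convolution_of_lipschitz {n : ℕ} {ψ : En n → ℝ} {K : ℝ≥0}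
    (hψ : LipschitzWith K ψ) (ρ : ContDiffBump (0 : En n)) (x v : En n) :
    fderiv ℝ (ρ.normed volume ⋆[ContinuousLinearMap.lsmul ℝ ℝ, volume] ψ) x v =
      (ρ.normed volume ⋆[ContinuousLinearMap.lsmul ℝ ℝ, volume]
        fun y => lineDeriv ℝ ψ y v) x := by
  have hρ1 : ContDiff ℝ 1 (ρ.normed (volume : Measure (En n))) := ρ.contDiff_normed
  have hρc : HasCompactSupport (ρ.normed (volume : Measure (En n))) := ρ.hasCompactSupport_normed
  have hder := hρc.hasFDerivAt_convolution_left (ContinuousLinearMap.lsmul ℝ ℝ) hρ1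
    (hψ.continuous.locallyIntegrable (μ := volume)) x
  obtain ⟨D, hD⟩ := hρ1.lipschitzWith_of_hasCompactSupport hρc one_ne_zero
  have hce : ConvolutionExistsAt (fderiv ℝ (ρ.normed (volume : Measure (En n)))) ψ x
      ((ContinuousLinearMap.lsmul ℝ ℝ).precompL (En n)) volume :=
    (hρc.fderiv ℝ).convolutionExists_left _ (hρ1.continuous_fderiv one_ne_zero)
      hψ.continuous.locallyIntegrable x
  rw [hder.fderiv]
  -- both sides are integrals against the reflected kernel `y ↦ ρ (x - y)`
  set g : En n → ℝ := fun y => ρ.normed volume (x - y) with hg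
  have hrefl : LipschitzWith 1 fun y : En n => x - y :=
    LipschitzWith.of_dist_le_mul fun a b => by rw [dist_sub_left, NNReal.coe_one, one_mul]
  have hgL : LipschitzWith (D * 1) g := hD.comp hrefl
  have hgc : HasCompactSupport g := hρc.comp_homeomorph (Homeomorph.subLeft x)
  have hgd : ∀ y, lineDeriv ℝ g y (-v) = fderiv ℝ (ρ.normed volume) (x - y) v := fun y => by
    have h1 : HasFDerivAt g ((fderiv ℝ (ρ.normed volume) (x - y)).comp
        (-ContinuousLinearMap.id ℝ (En n))) y :=
      ((hρ1.differentiable one_ne_zero) (x - y)).hasFDerivAt.comp y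
        ((hasFDerivAt_id y).const_sub x)
    rw [(h1.hasLineDerivAt (-v)).lineDeriv]
    simp
  have hibp := LipschitzWith.integral_lineDeriv_mul_eq (μ := volume) hψ hgL hgc v
  rw [convolution_eq_swap, convolution_lsmul_swap, ContinuousLinearMap.integral_apply
    hce.integrable_swap]
  simp only [hgd] at hibp
  simpa [ContinuousLinearMap.precompL_apply, mul_comm, hg] using hibp.symm

lemma support_normed_convolution_subset_closedBall {n : ℕ} {ψ : En n → ℝ} {x₀ : En n} {r s : ℝ}
    (hψ : ∀ x ∉ ball x₀ r, ψ x = 0) (ρ : ContDiffBump (0 : En n)) (hs : r + ρ.rOut ≤ s) :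
    Function.support (ρ.normed volume ⋆[ContinuousLinearMap.lsmul ℝ ℝ, volume] ψ) ⊆
      closedBall x₀ s := by
  intro x hx
  obtain ⟨a, ha, b, hb, rfl⟩ := support_convolution_subset _ hx
  rw [ρ.support_normed_eq, mem_ball_zero_iff] at ha
  have hb' : dist b x₀ < r := by
    by_contra h
    exact hb (hψ b h)
  have : dist (a + b) b = ‖a‖ := by simp [dist_eq_norm]
  rw [mem_closedBall]
  linarith [dist_triangle (a + b) b x₀]

/-- A one-sided bound on smooth test functions extends to Lipschitz test functions. -/
lemma integral_inner_gradient_nonneg_of_smooth {n : ℕ} {W : En n → En n} {x₀ : En n} {r s C : ℝ}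
    (hrs : r < s)
    (hWm : AEStronglyMeasurable W (volume.restrict (closedBall x₀ s)))
    (hWC : ∀ᵐ x ∂volume.restrict (closedBall x₀ s), ‖W x‖ ≤ C)
    (hW : ∀ ζ : En n → ℝ, ContDiff ℝ (⊤ : ℕ∞) ζ → tsupport ζ ⊆ closedBall x₀ s → (∀ x, 0 ≤ ζ x) →
      0 ≤ ∫ x in closedBall x₀ s, ⟪W x, gradient ζ x⟫)
    {ψ : En n → ℝ} {K : ℝ≥0} (hψ : LipschitzWith K ψ) (hψ0 : ∀ x, 0 ≤ ψ x)
    (hψr : ∀ x ∉ ball x₀ r, ψ x = 0) :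
    0 ≤ ∫ x in closedBall x₀ s, ⟪W x, gradient ψ x⟫ := by
  have hpos : ∀ k : ℕ, 0 < (s - r) / (k + 1) := fun k => div_pos (sub_pos.2 hrs) (by positivity)
  let ρ : ℕ → ContDiffBump (0 : En n) := fun k =>
    ⟨(s - r) / (k + 1) / 2, (s - r) / (k + 1), half_pos (hpos k), half_lt_self (hpos k)⟩
  have hρlim : Tendsto (fun k => (ρ k).rOut) atTop (𝓝 0) := by
    have := (tendsto_one_div_add_atTop_nhds_zero_nat (𝕜 := ℝ)).const_mul (s - r)
    simpa [ρ, div_eq_mul_inv] using this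
  let ζ : ℕ → En n → ℝ := fun k =>
    (ρ k).normed volume ⋆[ContinuousLinearMap.lsmul ℝ ℝ, volume] ψ
  have hζ : ∀ k, 0 ≤ ∫ x in closedBall x₀ s, ⟪W x, gradient (ζ k) x⟫ := by
    intro k
    refine hW _ ?_ ?_ ?_
    · exact (ρ k).hasCompactSupport_normed.contDiff_convolution_left _ (ρ k).contDiff_normed
        hψ.continuous.locallyIntegrable
    · refine closure_minimal (support_normed_convolution_subset_closedBall hψr _ ?_)
        isClosed_closedBall
      have : (s - r) / ((k : ℝ) + 1) ≤ s - r :=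
        div_le_self (sub_pos.2 hrs).le (by linarith [k.cast_nonneg (α := ℝ)])
      change r + (s - r) / ((k : ℝ) + 1) ≤ s
      linarith
    · intro x
      exact integral_nonneg fun t => mul_nonneg ((ρ k).nonneg_normed t) (hψ0 _)
  have hline : ∀ i x, ‖lineDeriv ℝ ψ x (EuclideanSpace.single i 1)‖ ≤ K := fun i x => by
    simpa using norm_lineDeriv_le_of_lipschitz ℝ hψ (x₀ := x) (v := EuclideanSpace.single i (1 : ℝ))
  have hgrad : ∀ k x i, gradient (ζ k) x i = ((ρ k).normed volume ⋆[ContinuousLinearMap.lsmul ℝ ℝ,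
      volume] fun y => lineDeriv ℝ ψ y (EuclideanSpace.single i 1)) x := fun k x i => by
    rw [gradient_apply_eq_fderiv_single, fderiv_normed_convolution_of_lipschitz hψ]
  have hgbound : ∀ k x i, ‖gradient (ζ k) x i‖ ≤ 3 * K := fun k x i => by
    have h1 : dist (gradient (ζ k) x i) (lineDeriv ℝ ψ x (EuclideanSpace.single i 1)) ≤ 2 * K := by
      rw [hgrad]
      refine ContDiffBump.dist_normed_convolution_le
        (measurable_lineDeriv hψ.continuous).aestronglyMeasurable fun y _ => ?_
      rw [dist_eq_norm]
      linarith [norm_sub_le (lineDeriv ℝ ψ y (EuclideanSpace.single i 1))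
        (lineDeriv ℝ ψ x (EuclideanSpace.single i 1)), hline i x, hline i y]
    rw [dist_eq_norm] at h1
    linarith [norm_le_norm_add_norm_sub' (gradient (ζ k) x i)
      (lineDeriv ℝ ψ x (EuclideanSpace.single i 1)), hline i x]
  have hconv : ∀ᵐ x, ∀ i, Tendsto (fun k => gradient (ζ k) x i) atTop (𝓝 (gradient ψ x i)) := by
    rw [ae_all_iff]
    intro i
    filter_upwards [ContDiffBump.ae_convolution_tendsto_right_of_locallyIntegrable (K := 2) hρlim
      (.of_forall fun k => by simp only [ρ]; linarith)
      (hψ.locallyIntegrable_lineDeriv (μ := volume) (EuclideanSpace.single i 1)),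
      hψ.ae_differentiableAt (μ := volume)] with x hx hdiff
    simp only [hgrad]
    rwa [gradient_apply_eq_fderiv_single, ← hdiff.lineDeriv_eq_fderiv]
  refine ge_of_tendsto' (tendsto_integral_of_dominated_convergence (fun _ => n * (C * (3 * K)))
    (fun k => ?_) ?_ (fun k => ?_) ?_) hζ
  · exact hWm.inner (measurable_gradient _).aestronglyMeasurable
  · exact integrableOn_const (isCompact_closedBall x₀ s).measure_lt_top.ne
  · filter_upwards [hWC] with x hx
    rw [real_inner_eq_sum_mul]
    refine (norm_sum_le_of_le (f := fun i => W x i * gradient (ζ k) x i)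
      (n := fun _ => C * (3 * K)) _ fun i _ => ?_).trans (by simp)
    rw [norm_mul]
    exact mul_le_mul ((PiLp.norm_apply_le _ i).trans hx) (hgbound k x i) (norm_nonneg _)
      ((norm_nonneg _).trans hx)
  · filter_upwards [ae_restrict_of_ae hconv] with x hx
    simp only [real_inner_eq_sum_mul]
    exact tendsto_finsetSum _ fun i _ => (hx i).const_mul _

lemma gradient_eq_zero_of_notMem_tsupport {n : ℕ} {f : En n → ℝ} {x : En n}
    (hx : x ∉ tsupport f) : gradient f x = 0 := by
  rw [gradient, fderiv_of_notMem_tsupport ℝ hx, map_zero]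

/-- Where `ψ` agrees with the positive part of `φ + c - u`, its gradient is `0` or `Dφ - Du`. -/
lemma gradient_eq_zero_or_eq_sub {n : ℕ} {φ u ψ : En n → ℝ} {c : ℝ} {x : En n}
    (hφ : DifferentiableAt ℝ φ x) (hψc : ContinuousAt ψ x) (hψ0 : ∀ y, 0 ≤ ψ y)
    (hψ : 0 < ψ x → ∀ᶠ y in 𝓝 x, ψ y = max (φ y + c - u y) 0) :
    gradient ψ x = 0 ∨ gradient ψ x = gradient φ x - gradient u x := by
  rcases (hψ0 x).eq_or_lt with h | h
  · left
    have hmin : IsLocalMin ψ x := .of_forall fun y => h ▸ hψ0 y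
    rw [gradient, hmin.fderiv_eq_zero, map_zero]
  · have heq : ψ =ᶠ[𝓝 x] fun y => φ y + c - u y := by
      filter_upwards [hψ h, hψc.eventually_const_lt h] with y hy hpos
      rw [hy] at hpos ⊢
      exact max_eq_left (by simpa using hpos : 0 < φ y + c - u y).le
    by_cases hu : DifferentiableAt ℝ u x
    · right
      have := (((hφ.hasFDerivAt.add_const c).sub hu.hasFDerivAt).congr_of_eventuallyEq heq).fderiv
      rw [gradient, gradient, gradient, this, map_sub]
    · left
      apply gradient_eq_zero_of_not_differentiableAt
      intro hd
      refine hu (((hφ.add_const c).sub hd).congr_of_eventuallyEq ?_)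
      filter_upwards [heq] with y hy
      simp [hy]

lemma aestronglyMeasurable_pFlux {n : ℕ} {p : En n → ℝ} (u : En n → ℝ) {s : Set (En n)}
    (hp : ContinuousOn p s) (hs : MeasurableSet s) :
    AEStronglyMeasurable (pFlux p u) (volume.restrict s) := by
  have hg : AEMeasurable (gradient u) (volume.restrict s) := (measurable_gradient u).aemeasurable
  have hpm : AEMeasurable p (volume.restrict s) := hp.aemeasurable hs
  exact ((hg.norm.pow (hpm.sub_const 2)).smul hg).aestronglyMeasurable

/-- Integration by parts for a Lipschitz field and a compactly supported Lipschitz function. -/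
lemma integral_sum_mul_gradient_eq_neg {n : ℕ} {V : Fin n → En n → ℝ} {L : Fin n → ℝ≥0}
    (hV : ∀ i, LipschitzWith (L i) (V i)) {ψ : En n → ℝ} {K : ℝ≥0} (hψ : LipschitzWith K ψ)
    {B : Set (En n)} (hB : IsCompact B) (hψB : tsupport ψ ⊆ B) :
    IntegrableOn (fun x => ∑ i, V i x * gradient ψ x i) B ∧
    Integrable (fun x => (∑ i, lineDeriv ℝ (V i) x (EuclideanSpace.single i 1)) * ψ x) ∧
    ∫ x in B, ∑ i, V i x * gradient ψ x i =
      -∫ x, (∑ i, lineDeriv ℝ (V i) x (EuclideanSpace.single i 1)) * ψ x := by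
  have hψc : HasCompactSupport ψ := hB.of_isClosed_subset (isClosed_tsupport ψ) hψB
  have hint1 : ∀ i, IntegrableOn (fun x => V i x * gradient ψ x i) B := fun i => by
    refine Integrable.mul_bdd (c := K) ((hV i).continuous.continuousOn.integrableOn_compact hB)
      ?_ (.of_forall fun x => ?_)
    · simp only [gradient_apply_eq_fderiv_single]
      exact (measurable_fderiv_apply_const ℝ ψ _).aestronglyMeasurable
    · refine (PiLp.norm_apply_le _ i).trans ?_
      rw [norm_gradient]
      exact norm_fderiv_le_of_lipschitz ℝ hψ
  have hint2 : ∀ i, Integrable fun x =>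
      lineDeriv ℝ (V i) x (EuclideanSpace.single i 1) * ψ x := fun i => by
    refine Integrable.bdd_mul (c := L i * ‖EuclideanSpace.single i (1 : ℝ)‖)
      (hψ.continuous.integrable_of_hasCompactSupport hψc)
      (measurable_lineDeriv (hV i).continuous).aestronglyMeasurable
      (.of_forall fun x => norm_lineDeriv_le_of_lipschitz ℝ (hV i))
  refine ⟨integrable_finsetSum _ fun i _ => hint1 i, ?_, ?_⟩
  · simp only [Finset.sum_mul]
    exact integrable_finsetSum _ fun i _ => hint2 i
  simp only [Finset.sum_mul]
  rw [integral_finsetSum _ fun i _ => hint1 i, integral_finsetSum _ fun i _ => hint2 i,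
    ← Finset.sum_neg_distrib]
  refine Finset.sum_congr rfl fun i _ => ?_
  rw [(hV i).integral_lineDeriv_mul_eq hψ hψc, setIntegral_eq_integral_of_forall_compl_eq_zero,
    ← integral_neg]
  · refine integral_congr_ae ?_
    filter_upwards [hψ.ae_differentiableAt (μ := volume)] with x hx
    rw [lineDeriv_neg, gradient_apply_eq_fderiv_single, hx.lineDeriv_eq_fderiv]
    ring
  · intro x hx
    simp [gradient_eq_zero_of_notMem_tsupport fun h => hx (hψB h)]

/-- weak supersolutions are viscosity supersolutions. -/
theorem stmt3
    {n : ℕ} (hn : 1 ≤ n)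
    (Ω : Set (En n)) (hΩo : IsOpen Ω) (hΩb : Bornology.IsBounded Ω)
    (p : En n → ℝ) (hp : ContDiffOn ℝ 1 p Ω)
    (pminus pplus : ℝ) (hpm : 1 < pminus)
    (hprange : ∀ x ∈ Ω, pminus ≤ p x ∧ p x ≤ pplus)
    (u : En n → ℝ) (hcont : ContinuousOn u Ω) (hlip : LocLipschitzOn u Ω)
    (hweak : ∀ ψ : En n → ℝ, ContDiff ℝ (⊤ : ℕ∞) ψ → HasCompactSupport ψ →
      tsupport ψ ⊆ Ω → (∀ x, 0 ≤ ψ x) →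
      0 ≤ ∫ x in Ω, weakIntegrand p u ψ x) :
    IsViscositySupersolution p u Ω := by
  intro x₀ hx₀ φ hφ hφu hlt h0
  by_contra! hneg
  have hΩx : Ω ∈ 𝓝 x₀ := hΩo.mem_nhds hx₀
  have hpx : ContDiffAt ℝ 1 p x₀ := hp.contDiffAt hΩx
  have hV : ContDiffAt ℝ 1 (pFlux p φ) x₀ := contDiffAt_pFlux hφ hpx h0
  have hdiv : ∀ᶠ x in 𝓝 x₀,
      0 < ∑ i, fderiv ℝ (pFlux p φ) x (EuclideanSpace.single i 1) i := by
    have hc : ContinuousAt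
        (fun x => ∑ i, fderiv ℝ (pFlux p φ) x (EuclideanSpace.single i 1) i) x₀ := by
      have := hV.continuousAt_fderiv one_ne_zero
      fun_prop
    refine hc.eventually_const_lt ?_
    beta_reduce
    rw [sum_fderiv_pFlux hφ (hpx.differentiableAt one_ne_zero) h0]
    linarith
  have hVd : ∀ᶠ x in 𝓝 x₀, DifferentiableAt ℝ (pFlux p φ) x :=
    (hV.eventually (by simp)).mono fun x hx => hx.differentiableAt one_ne_zero
  have hφd : ∀ᶠ x in 𝓝 x₀, DifferentiableAt ℝ φ x :=
    (hφ.eventually (by simp)).mono fun x hx => hx.differentiableAt two_ne_zero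
  obtain ⟨KV, tV, htV, hLV⟩ := hV.exists_lipschitzOnWith
  obtain ⟨Kφ, tφ, htφ, hLφ⟩ := (hφ.of_le one_le_two).exists_lipschitzOnWith
  obtain ⟨Ku, tu, htu, hLu⟩ := hlip x₀ hx₀
  rw [nhdsWithin_eq_nhds.2 hΩx] at htu
  have hlt' : ∀ᶠ x in 𝓝 x₀, x ≠ x₀ → φ x < u x := eventually_nhdsWithin_iff.1 hlt
  obtain ⟨R, hR, hball⟩ := Metric.eventually_nhds_iff_ball.1
    (hdiv.and (hVd.and (hφd.and (hlt'.and
      ((eventually_mem_set.2 htV).and ((eventually_mem_set.2 htφ).and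
        ((eventually_mem_set.2 htu).and (eventually_mem_set.2 hΩx))))))))
  obtain ⟨s, hs0, hsR⟩ := exists_between hR
  obtain ⟨r, hr0, hrs⟩ := exists_between hs0
  have hsub : closedBall x₀ s ⊆ ball x₀ R := closedBall_subset_ball hsR
  have hrs' : closedBall x₀ r ⊆ closedBall x₀ s := closedBall_subset_closedBall hrs.le
  choose! bdiv bVd bφd blt bV bφ bu bΩ using hball
  -- lower bound of `u - φ` on a sphere
  obtain ⟨c, hc0, hc⟩ : ∃ c, 0 < c ∧ ∀ x ∈ sphere x₀ r, c ≤ u x - φ x := by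
    have hcont' : ContinuousOn (fun x => u x - φ x) (sphere x₀ r) := by
      have hsph : sphere x₀ r ⊆ ball x₀ R := sphere_subset_closedBall.trans (hrs'.trans hsub)
      exact (hcont.mono fun x hx => bΩ x (hsph hx)).sub
        fun x hx => (bφd x (hsph hx)).continuousAt.continuousWithinAt
    refine (isCompact_sphere x₀ r).exists_forall_le' hcont' fun x hx => ?_
    have hne : x ≠ x₀ := by
      rintro rfl
      simp [hr0.ne] at hx
    exact sub_pos.2 (blt x (hsub (hrs' (sphere_subset_closedBall hx))) hne)
  have hLf : LipschitzOnWith (Kφ + 0 + Ku) (fun x => φ x + c - u x) (closedBall x₀ r) :=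
    ((hLφ.mono fun x hx => bφ x (hsub (hrs' hx))).add (LipschitzWith.const c).lipschitzOnWith).sub
      (hLu.mono fun x hx => bu x (hsub (hrs' hx)))
  obtain ⟨ψ, K, hψL, hψf, hψr⟩ := hLf.exists_lipschitzWith_posPart_ball hr0
    fun x hx => by linarith [hc x hx]
  have hψ0 : ∀ x, 0 ≤ ψ x := fun x => by
    by_cases hx : x ∈ ball x₀ r
    · rw [hψf x (ball_subset_closedBall hx)]; exact le_max_right _ _
    · exact (hψr x hx).ge
  have hψsupp : tsupport ψ ⊆ closedBall x₀ s := by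
    refine closure_minimal (fun x hx => ?_) isClosed_closedBall
    by_contra h
    exact hx (hψr x fun hxr => h (hrs' (ball_subset_closedBall hxr)))
  have hBcpt : IsCompact (closedBall x₀ s) := isCompact_closedBall x₀ s
  have hsΩ : closedBall x₀ s ⊆ Ω := fun x hx => bΩ x (hsub hx)
  have hfluxm : AEStronglyMeasurable (pFlux p u) (volume.restrict (closedBall x₀ s)) :=
    aestronglyMeasurable_pFlux u (hp.continuousOn.mono hsΩ) measurableSet_closedBall
  have hfluxb : ∀ᵐ x ∂volume.restrict (closedBall x₀ s),
      ‖pFlux p u x‖ ≤ (1 + Ku) ^ (pplus - 1) := by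
    refine ae_restrict_of_forall_mem measurableSet_closedBall fun x hx => ?_
    obtain ⟨h1, h2⟩ := hprange x (hsΩ hx)
    refine norm_pFlux_le (hpm.trans_le h1) h2 ?_
    rw [norm_gradient]
    exact norm_fderiv_le_of_lipschitzOn ℝ (isOpen_ball.mem_nhds (hsub hx)) (hLu.mono bu)
  -- the weak inequality tested with `ψ`
  have hweakψ : 0 ≤ ∫ x in closedBall x₀ s, ⟪pFlux p u x, gradient ψ x⟫ := by
    refine integral_inner_gradient_nonneg_of_smooth hrs hfluxm hfluxb (fun ζ hζ hζs hζ0 => ?_)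
      hψL hψ0 hψr
    have h := hweak ζ hζ (hBcpt.of_isClosed_subset (isClosed_tsupport ζ) hζs)
      (hζs.trans hsΩ) hζ0
    simp only [weakIntegrand_eq_inner_pFlux] at h
    rwa [setIntegral_eq_of_subset_of_forall_sdiff_eq_zero hΩo.measurableSet hsΩ fun x hx => ?_] at h
    rw [gradient_eq_zero_of_notMem_tsupport fun hx' => hx.2 (hζs hx'), inner_zero_right]
  -- Lipschitz extensions of the components of the flux of `φ`
  have hext : ∀ i : Fin n, ∃ g : En n → ℝ, LipschitzWith KV g ∧
      EqOn (fun x => pFlux p φ x i) g (ball x₀ R) := fun i =>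
    LipschitzOnWith.extend_real <| LipschitzOnWith.of_dist_le_mul fun x hx y hy =>
      (by simpa [dist_eq_norm] using PiLp.norm_apply_le (pFlux p φ x - pFlux p φ y) i :
        dist (pFlux p φ x i) (pFlux p φ y i) ≤ dist (pFlux p φ x) (pFlux p φ y)).trans
        (hLV.dist_le_mul x (bV x hx) y (bV y hy))
  choose V hVL hVeq using hext
  have hVline : ∀ x ∈ ball x₀ R, ∑ i, lineDeriv ℝ (V i) x (EuclideanSpace.single i 1) =
      ∑ i, fderiv ℝ (pFlux p φ) x (EuclideanSpace.single i 1) i := fun x hx => by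
    refine Finset.sum_congr rfl fun i _ => ?_
    have h1 : HasFDerivAt (fun y => pFlux p φ y i)
        ((EuclideanSpace.proj i : En n →L[ℝ] ℝ).comp (fderiv ℝ (pFlux p φ) x)) x :=
      (EuclideanSpace.proj i : En n →L[ℝ] ℝ).hasFDerivAt.comp x (bVd x hx).hasFDerivAt
    have h2 := h1.congr_of_eventuallyEq
      (((hVeq i).eventuallyEq_of_mem (isOpen_ball.mem_nhds hx)).symm)
    rw [(h2.hasLineDerivAt _).lineDeriv]
    simp
  obtain ⟨hint1, hint2, hibp⟩ := integral_sum_mul_gradient_eq_neg hVL hψL hBcpt hψsupp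
  have hmono : ∫ x in closedBall x₀ s, ⟪pFlux p u x, gradient ψ x⟫ ≤
      ∫ x in closedBall x₀ s, ∑ i, V i x * gradient ψ x i := by
    refine setIntegral_mono_on ?_ hint1 measurableSet_closedBall fun x hx => ?_
    · have hconst : IntegrableOn (fun _ : En n => (1 + (Ku : ℝ)) ^ (pplus - 1) * (K : ℝ))
          (closedBall x₀ s) volume := integrableOn_const hBcpt.measure_lt_top.ne
      refine Integrable.mono' hconst (hfluxm.inner (measurable_gradient _).aestronglyMeasurable) ?_
      filter_upwards [hfluxb] with x hx
      refine (norm_inner_le_norm _ _).trans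
        (mul_le_mul hx ?_ (norm_nonneg _) ((norm_nonneg _).trans hx))
      rw [norm_gradient]
      exact norm_fderiv_le_of_lipschitz ℝ hψL
    · have hVx : ∑ i, V i x * gradient ψ x i = ⟪pFlux p φ x, gradient ψ x⟫ := by
        rw [real_inner_eq_sum_mul]
        exact Finset.sum_congr rfl fun i _ => by rw [← hVeq i (hsub hx)]
      rw [hVx]
      have hev : 0 < ψ x → ∀ᶠ y in 𝓝 x, ψ y = max (φ y + c - u y) 0 := fun hpos => by
        have hxr : x ∈ ball x₀ r := by
          by_contra hxr
          exact hpos.ne' (hψr x hxr)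
        filter_upwards [isOpen_ball.mem_nhds hxr] with y hy
        exact hψf y (ball_subset_closedBall hy)
      rcases gradient_eq_zero_or_eq_sub (bφd x (hsub hx)) hψL.continuous.continuousAt hψ0 hev
        with h | h
      · simp [h]
      · rw [h]
        exact inner_rpow_smul_sub_le (hpm.trans_le (hprange x (hsΩ hx)).1) _ _
  have hpos : 0 < ∫ x, (∑ i, lineDeriv ℝ (V i) x (EuclideanSpace.single i 1)) * ψ x := by
    have hlinepos : ∀ x, ψ x ≠ 0 →
        0 < ∑ i, lineDeriv ℝ (V i) x (EuclideanSpace.single i 1) := fun x hx => by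
      have hxR : x ∈ ball x₀ R := hsub (hψsupp (subset_tsupport ψ hx))
      rw [hVline x hxR]
      exact bdiv x hxR
    rw [integral_pos_iff_support_of_nonneg (fun x => ?_) hint2]
    · have hsupp : Function.support
          (fun x => (∑ i, lineDeriv ℝ (V i) x (EuclideanSpace.single i 1)) * ψ x) =
          Function.support ψ := by
        ext x
        simp only [Function.mem_support, mul_ne_zero_iff]
        exact ⟨fun h => h.2, fun h => ⟨(hlinepos x h).ne', h⟩⟩
      rw [hsupp]
      refine hψL.continuous.isOpen_support.measure_pos volume ⟨x₀, ?_⟩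
      rw [Function.mem_support, hψf x₀ (mem_closedBall_self hr0.le), hφu]
      simp [hc0]
    · rcases eq_or_ne (ψ x) 0 with h | h
      · simp [h]
      · exact mul_nonneg (hlinepos x h).le (hψ0 x)
  linarith
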